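/- arXiv:1506.00605 — 2 statements merged into one kernel-verified Lean document; each statement's English description precedes it below -/
import Mathlib

section
/- (Uniqueness up to a common additive constant for the nonlinear system.) If (u₁,v₁) and (u₂,v₂) are two classical solutions of system (P), then there exists a constant s ∈ ℝ such that u₂(x) − u₁(x) = s for all x ∈ [0,L], v₂(x) − v₁(x) = s for all x ∈ [0,L₁], and v₂(x) − v₁(x) = s for all x ∈ [L₁+δ, L]. -/
open Set MeasureTheory intervalIntegral

/-- The Butler–Volmer nonlinearity `E(x,w) = exp(a(w − f x)) − exp(−b(w − f x))`. -/
noncomputable def E (a b : ℝ) (f : ℝ → ℝ) (x w : ℝ) : ℝ :=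
  Real.exp (a * (w - f x)) - Real.exp (-b * (w - f x))

/-- The flux term `−(r u′) + ν·(r (ln c)′)` appearing in the electrolyte equation. -/
noncomputable def flux (r c : ℝ → ℝ) (ν : ℝ) (u : ℝ → ℝ) : ℝ → ℝ :=
  fun y => -(r y * deriv u y) + ν * (r y * deriv c y / c y)

/-- A classical solution `(u, v)` of the system. -/
def IsSolution (L₁ δ L a b ν dm dp km kp qm qp : ℝ)
    (f r c bm bp u v : ℝ → ℝ) : Prop :=
  -- `u` is continuously differentiable on `[0, L]`
  ContDiffOn ℝ 1 u (Icc 0 L) ∧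
  -- `r·u′` is differentiable on `(0, L)`
  DifferentiableOn ℝ (fun y => r y * deriv u y) (Ioo 0 L) ∧
  -- `v` is twice differentiable on `[0, L₁]` and on `[L₁+δ, L]`
  (∀ x ∈ Icc 0 L₁ ∪ Icc (L₁ + δ) L,
      DifferentiableAt ℝ v x ∧ DifferentiableAt ℝ (deriv v) x) ∧
  -- electrolyte-potential equation on the negative electrode
  (∀ x ∈ Ioo 0 L₁, deriv (flux r c ν u) x = km * bm x * E a b f x (v x - u x)) ∧
  -- electrolyte-potential equation on the separator
  (∀ x ∈ Ioo L₁ (L₁ + δ), deriv (flux r c ν u) x = 0) ∧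
  -- electrolyte-potential equation on the positive electrode
  (∀ x ∈ Ioo (L₁ + δ) L, deriv (flux r c ν u) x = kp * bp x * E a b f x (v x - u x)) ∧
  -- boundary conditions for `u`
  deriv u 0 = 0 ∧ deriv u L = 0 ∧
  -- solid-potential equation on the negative electrode (`−v″ = −(⋯)`)
  (∀ x ∈ Ioo 0 L₁, deriv (deriv v) x = qm * bm x * E a b f x (v x - u x)) ∧
  -- solid-potential equation on the positive electrode (`−v″ = −(⋯)`)
  (∀ x ∈ Ioo (L₁ + δ) L, deriv (deriv v) x = qp * bp x * E a b f x (v x - u x)) ∧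
  -- boundary conditions for `v`: `−v′(0) = d₋`, `v′(L) = −d₊`, `v′(L₁) = v′(L₁+δ) = 0`
  deriv v 0 = -dm ∧ deriv v L = -dp ∧ deriv v L₁ = 0 ∧ deriv v (L₁ + δ) = 0

/-- `E` is strictly increasing in its second variable. -/
theorem E_strictMono {a b : ℝ} (ha : 0 < a) (hb : 0 < b) (f : ℝ → ℝ) (x : ℝ) :
    StrictMono (E a b f x) := by
  intro w₁ w₂ h
  have h₁ : Real.exp (a * (w₁ - f x)) < Real.exp (a * (w₂ - f x)) :=
    Real.exp_lt_exp.2 (mul_lt_mul_of_pos_left (by linarith) ha)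
  have h₂ : Real.exp (-b * (w₂ - f x)) < Real.exp (-b * (w₁ - f x)) :=
    Real.exp_lt_exp.2 (mul_lt_mul_of_neg_left (by linarith) (by linarith))
  unfold E
  linarith

theorem eq_of_hasDerivAt_zero {g : ℝ → ℝ} {α β : ℝ} (h : α ≤ β)
    (hg : ContinuousOn g (Icc α β)) (hg' : ∀ x ∈ Ioo α β, HasDerivAt g 0 x) : g α = g β := by
  rcases h.eq_or_lt with rfl | h
  · rfl
  obtain ⟨c, -, hc⟩ := exists_hasDerivAt_eq_slope g (fun _ => 0) h hg hg'
  have : β - α ≠ 0 := by linarith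
  field_simp at hc
  linarith

/-- Energy argument: if `p' y ≥ 0`, `y' = m p` with `m > 0` and `p` vanishes at both ends, then `p`
and `y` vanish identically. -/
theorem eqOn_zero_of_energy {α β : ℝ} (h : α < β) {p y g m : ℝ → ℝ}
    (hp : ContinuousOn p (Icc α β)) (hy : ContinuousOn y (Icc α β))
    (hp' : ∀ x ∈ Ioo α β, HasDerivAt p (g x) x)
    (hy' : ∀ x ∈ Ioo α β, HasDerivAt y (m x * p x) x)
    (hm : ∀ x ∈ Ioo α β, 0 < m x)
    (hg : ∀ x ∈ Ioo α β, y x ≠ 0 → 0 < g x * y x)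
    (hα : p α = 0) (hβ : p β = 0) :
    EqOn p 0 (Icc α β) ∧ EqOn y 0 (Icc α β) := by
  have hF' : ∀ x ∈ Ioo α β,
      HasDerivAt (fun t => p t * y t) (g x * y x + p x * (m x * p x)) x :=
    fun x hx => (hp' x hx).mul (hy' x hx)
  have hgy : ∀ x ∈ Ioo α β, 0 ≤ g x * y x := by
    intro x hx
    by_cases h0 : y x = 0
    · simp [h0]
    · exact (hg x hx h0).le
  have hmp : ∀ x ∈ Ioo α β, 0 ≤ p x * (m x * p x) := by
    intro x hx
    nlinarith [mul_nonneg (hm x hx).le (mul_self_nonneg (p x))]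
  have hmono : MonotoneOn (fun t => p t * y t) (Icc α β) := by
    refine monotoneOn_of_deriv_nonneg (convex_Icc α β) (hp.mul hy) ?_ ?_
    · rw [interior_Icc]
      exact fun x hx => (hF' x hx).differentiableAt.differentiableWithinAt
    · rw [interior_Icc]
      intro x hx
      rw [(hF' x hx).deriv]
      exact add_nonneg (hgy x hx) (hmp x hx)
  have hzero : ∀ x ∈ Icc α β, p x * y x = 0 := by
    intro x hx
    have h₁ := hmono (left_mem_Icc.2 h.le) hx hx.1
    have h₂ := hmono hx (right_mem_Icc.2 h.le) hx.2
    simp only [hα, hβ, zero_mul] at h₁ h₂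
    exact le_antisymm h₂ h₁
  have hint : ∀ x ∈ Ioo α β, p x = 0 ∧ y x = 0 := by
    intro x hx
    have hev : (fun t => p t * y t) =ᶠ[nhds x] fun _ => 0 := by
      filter_upwards [Ioo_mem_nhds hx.1 hx.2] with t ht
      exact hzero t (Ioo_subset_Icc_self ht)
    have hsum : g x * y x + p x * (m x * p x) = 0 :=
      (hF' x hx).unique ((hasDerivAt_const x (0 : ℝ)).congr_of_eventuallyEq hev)
    have h₁ := hgy x hx
    have h₂ := hmp x hx
    constructor
    · have h₃ : p x * (m x * p x) = 0 := by linarith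
      simpa [(hm x hx).ne'] using h₃
    · by_contra h0
      linarith [hg x hx h0]
  have hcl : closure (Ioo α β) = Icc α β := closure_Ioo h.ne
  constructor
  · exact Set.EqOn.of_subset_closure (fun x hx => (hint x hx).1) hp continuousOn_const
      Ioo_subset_Icc_self hcl.ge
  · exact Set.EqOn.of_subset_closure (fun x hx => (hint x hx).2) hy continuousOn_const
      Ioo_subset_Icc_self hcl.ge

/-- A positive through-flux `A` is incompatible with `y β = 0` and `p α = p β = 0` when
`y' = p - (A - κ p) / r` and `p' > 0` wherever `y > 0`. -/
theorem not_pos_of_boundary_zero {α β κ A : ℝ} (h : α < β) (hκ : 0 < κ) {p y g r : ℝ → ℝ}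
    (hp : ContinuousOn p (Icc α β)) (hy : ContinuousOn y (Icc α β))
    (hr : ContinuousOn r (Icc α β)) (hrpos : ∀ x ∈ Icc α β, 0 < r x)
    (hp' : ∀ x ∈ Ioo α β, HasDerivAt p (g x) x)
    (hy' : ∀ x ∈ Ioo α β, HasDerivAt y (p x - (A - κ * p x) / r x) x)
    (hg : ∀ x ∈ Ioo α β, 0 < y x → 0 < g x)
    (hα : p α = 0) (hβ : p β = 0) (hyβ : y β = 0) : ¬ 0 < A := by
  intro hA
  have hpos_of : ∀ s ∈ Icc α β, s < β →
      (∀ x ∈ Ioo s β, p x * (r x + κ) - A < 0) → ∀ x ∈ Ico s β, 0 < y x := by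
    intro s hs hsβ hneg x hx
    have hanti : StrictAntiOn y (Icc s β) := by
      refine strictAntiOn_of_deriv_neg (convex_Icc s β)
        (hy.mono (Icc_subset_Icc_left hs.1)) ?_
      rw [interior_Icc]
      intro t ht
      have ht' : t ∈ Ioo α β := ⟨hs.1.trans_lt ht.1, ht.2⟩
      have hrt := hrpos t (Ioo_subset_Icc_self ht')
      rw [(hy' t ht').deriv]
      have : p t - (A - κ * p t) / r t = (p t * (r t + κ) - A) / r t := by
        field_simp
        ring
      rw [this]
      exact div_neg_of_neg_of_pos (hneg t ht) hrt
    have := hanti ⟨hx.1, hx.2.le⟩ (right_mem_Icc.2 hsβ.le) hx.2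
    rwa [hyβ] at this
  have hp_mono : ∀ s ∈ Icc α β, (∀ x ∈ Ioo s β, 0 < y x) → StrictMonoOn p (Icc s β) := by
    intro s hs hpos
    refine strictMonoOn_of_deriv_pos (convex_Icc s β) (hp.mono (Icc_subset_Icc_left hs.1)) ?_
    rw [interior_Icc]
    intro t ht
    have ht' : t ∈ Ioo α β := ⟨hs.1.trans_lt ht.1, ht.2⟩
    rw [(hp' t ht').deriv]
    exact hg t ht' (hpos t ht)
  have hβm : β ∈ Icc α β := right_mem_Icc.2 h.le
  obtain ⟨s₀, hs₀, hs₀y⟩ : ∃ s ∈ Ico α β, ∀ x ∈ Ico s β, 0 < y x := by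
    have hc : ContinuousWithinAt (fun x => p x * (r x + κ) - A) (Icc α β) β :=
      ((hp β hβm).mul ((hr β hβm).add continuousWithinAt_const)).sub continuousWithinAt_const
    have hlt : p β * (r β + κ) - A < 0 := by simp [hβ, hA]
    have hev : ∀ᶠ x in nhdsWithin β (Iio β), p x * (r x + κ) - A < 0 := by
      have := hc.eventually (gt_mem_nhds hlt)
      rw [nhdsWithin_Icc_eq_nhdsLE h] at this
      exact this.filter_mono (nhdsWithin_mono _ Iio_subset_Iic_self)
    obtain ⟨l, hl, hlsub⟩ := (mem_nhdsLT_iff_exists_mem_Ico_Ioo_subset h).1 hev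
    exact ⟨l, hl, hpos_of l ⟨hl.1, hl.2.le⟩ hl.2 (fun x hx => hlsub hx)⟩
  have hall : ∀ x ∈ Ico α β, 0 < y x := by
    by_contra! hcon
    obtain ⟨x₀, hx₀, hyx₀⟩ := hcon
    have hx₀s : x₀ < s₀ := by
      by_contra! hle
      linarith [hs₀y x₀ ⟨hle, hx₀.2⟩]
    have hKc : IsCompact (Icc x₀ s₀ ∩ y ⁻¹' Iic 0) :=
      isCompact_Icc.of_isClosed_subset
        ((hy.mono (Icc_subset_Icc hx₀.1 hs₀.2.le)).preimage_isClosed_of_isClosed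
          isClosed_Icc isClosed_Iic) inter_subset_left
    obtain ⟨s, ⟨hsI, hsy⟩, hsmax⟩ := hKc.exists_isGreatest ⟨x₀, ⟨le_rfl, hx₀s.le⟩, hyx₀⟩
    have hs : s ∈ Icc α β := ⟨hx₀.1.trans hsI.1, hsI.2.trans hs₀.2.le⟩
    have hsβ : s < β := hsI.2.trans_lt hs₀.2
    have hpos : ∀ x ∈ Ioo s β, 0 < y x := by
      intro x hx
      by_contra! hyx
      rcases lt_or_ge x s₀ with hxs | hxs
      · exact absurd (hsmax ⟨⟨hsI.1.trans hx.1.le, hxs.le⟩, hyx⟩) (not_le.2 hx.1)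
      · linarith [hs₀y x ⟨hxs, hx.2⟩]
    have hmono := hp_mono s hs hpos
    have hys : 0 < y s := by
      refine hpos_of s hs hsβ (fun x hx => ?_) s ⟨le_rfl, hsβ⟩
      have hpx := hmono ⟨hx.1.le, hx.2.le⟩ (right_mem_Icc.2 hsβ.le) hx.2
      have hrx := hrpos x ⟨hs.1.trans hx.1.le, hx.2.le⟩
      rw [hβ] at hpx
      nlinarith [mul_pos (neg_pos.2 hpx) (add_pos hrx hκ)]
    exact absurd hsy (not_le.2 hys)
  have hαm : α ∈ Icc α β := left_mem_Icc.2 h.le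
  have := hp_mono α hαm (fun x hx => hall x ⟨hx.1.le, hx.2⟩) hαm hβm h
  linarith

/-- The derivative of the flux exists at an interface, so the reaction term on its left matches
the vanishing source on its right. -/
theorem eq_zero_of_deriv_interface {F S : ℝ → ℝ} {α x₀ β : ℝ} (h₁ : α < x₀) (h₂ : x₀ < β)
    (hF : ∀ x ∈ Ioo α β, DifferentiableAt ℝ F x)
    (hl : ∀ x ∈ Ioo α x₀, deriv F x = S x) (hr : ∀ x ∈ Ioo x₀ β, deriv F x = 0)
    (hS : ContinuousWithinAt S (Ioo α x₀) x₀) : S x₀ = 0 := by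
  have hd : DifferentiableAt ℝ F x₀ := hF x₀ ⟨h₁, h₂⟩
  have hR : HasDerivWithinAt F 0 (Ici x₀) x₀ := by
    refine hasDerivWithinAt_Ici_of_tendsto_deriv (s := Ioo x₀ β)
      (fun x hx => (hF x ⟨h₁.trans hx.1, hx.2⟩).differentiableWithinAt)
      hd.continuousAt.continuousWithinAt (Ioo_mem_nhdsGT h₂) ?_
    refine tendsto_const_nhds.congr' ?_
    filter_upwards [Ioo_mem_nhdsGT h₂] with x hx using (hr x hx).symm
  have hL : HasDerivWithinAt F (S x₀) (Iic x₀) x₀ := by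
    refine hasDerivWithinAt_Iic_of_tendsto_deriv (s := Ioo α x₀)
      (fun x hx => (hF x ⟨hx.1, hx.2.trans h₂⟩).differentiableWithinAt)
      hd.continuousAt.continuousWithinAt (Ioo_mem_nhdsLT h₁) ?_
    have hS' : Filter.Tendsto S (nhdsWithin x₀ (Iio x₀)) (nhds (S x₀)) := by
      have := hS.tendsto
      rwa [nhdsWithin_Ioo_eq_nhdsLT h₁] at this
    refine hS'.congr' ?_
    filter_upwards [Ioo_mem_nhdsLT h₁] with x hx using (hl x hx).symm
  rw [(uniqueDiffWithinAt_Iic x₀).eq_deriv _ hL hd.hasDerivAt.hasDerivWithinAt,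
    (uniqueDiffWithinAt_Ici x₀).eq_deriv _ hd.hasDerivAt.hasDerivWithinAt hR]

theorem uniqueness_up_to_constant (L₁ δ L a b ν dm dp km kp qm qp : ℝ) (f r c bm bp : ℝ → ℝ) (u₁ v₁ u₂ v₂ : ℝ → ℝ)
    (hL₁ : 0 < L₁) (hδ : 0 < δ) (hL : L₁ + δ < L)
    (ha : 0 < a) (hb : 0 < b) (hf : Continuous f)
    (hr : ContDiffOn ℝ 1 r (Icc 0 L)) (hrpos : ∀ x ∈ Icc 0 L, 0 < r x)
    (hc : ContDiffOn ℝ 1 c (Icc 0 L)) (hcpos : ∀ x ∈ Icc 0 L, 0 < c x)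
    (hc0 : deriv c 0 = 0) (hcL : deriv c L = 0)
    (hrlc : DifferentiableOn ℝ (fun y => r y * deriv c y / c y) (Ioo 0 L))
    (hbm : ContinuousOn bm (Icc 0 L₁)) (hbmpos : ∀ x ∈ Icc 0 L₁, 0 < bm x)
    (hbp : ContinuousOn bp (Icc (L₁ + δ) L)) (hbppos : ∀ x ∈ Icc (L₁ + δ) L, 0 < bp x)
    (hkm : 0 < km) (hkp : 0 < kp) (hqm : 0 < qm) (hqp : 0 < qp)
    (hsol₁ : IsSolution L₁ δ L a b ν dm dp km kp qm qp f r c bm bp u₁ v₁)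
    (hsol₂ : IsSolution L₁ δ L a b ν dm dp km kp qm qp f r c bm bp u₂ v₂) :
    ∃ s : ℝ, (∀ x ∈ Icc (0:ℝ) L, u₂ x - u₁ x = s) ∧
      (∀ x ∈ Icc (0:ℝ) L₁, v₂ x - v₁ x = s) ∧
      (∀ x ∈ Icc (L₁ + δ) L, v₂ x - v₁ x = s) := by
  obtain ⟨hu₁, hru₁, hv₁, hnu₁, hsu₁, hpu₁, -, -, hnv₁, hpv₁, h0₁, he₁, hi₁, hj₁⟩ := hsol₁
  obtain ⟨hu₂, hru₂, hv₂, hnu₂, hsu₂, hpu₂, -, -, hnv₂, hpv₂, h0₂, he₂, hi₂, hj₂⟩ := hsol₂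
  have hflux : ∀ {u : ℝ → ℝ}, DifferentiableOn ℝ (fun y => r y * deriv u y) (Ioo 0 L) →
      ∀ x ∈ Ioo 0 L, DifferentiableAt ℝ (flux r c ν u) x := by
    intro u hu x hx
    have hnhds := Ioo_mem_nhds hx.1 hx.2
    exact ((hu x hx).differentiableAt hnhds).neg.add
      (((hrlc x hx).differentiableAt hnhds).const_mul ν)
  have hderiv : ∀ {u : ℝ → ℝ}, ContDiffOn ℝ 1 u (Icc 0 L) →
      ∀ x ∈ Ioo 0 L, HasDerivAt u (deriv u x) x := fun hu x hx =>
    ((hu.differentiableOn one_ne_zero).differentiableAt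
      (Icc_mem_nhds hx.1 hx.2)).hasDerivAt
  -- `p` is the derivative of `v₂ - v₁`, and `φ` is `r` times the derivative of `w = u₂ - u₁`.
  set p : ℝ → ℝ := fun x => deriv v₂ x - deriv v₁ x with hp_def
  set w : ℝ → ℝ := fun x => u₂ x - u₁ x with hw_def
  set y : ℝ → ℝ := fun x => (v₂ x - u₂ x) - (v₁ x - u₁ x) with hy_def
  set φ : ℝ → ℝ := fun x => flux r c ν u₁ x - flux r c ν u₂ x with hφ_def
  set D : ℝ → ℝ := fun x => E a b f x (v₂ x - u₂ x) - E a b f x (v₁ x - u₁ x) with hD_def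
  have hDpos : ∀ x, 0 < y x → 0 < D x := fun x hx =>
    sub_pos.2 (E_strictMono ha hb f x (sub_pos.1 hx))
  have hDneg : ∀ x, y x < 0 → D x < 0 := fun x hx =>
    sub_neg.2 (E_strictMono ha hb f x (sub_neg.1 hx))
  have hDy : ∀ x, y x ≠ 0 → 0 < D x * y x := by
    intro x hx
    rcases hx.lt_or_gt with h | h
    · exact mul_pos_of_neg_of_neg (hDneg x h) h
    · exact mul_pos (hDpos x h) h
  have hnL : Icc 0 L₁ ⊆ Icc 0 L := Icc_subset_Icc_right (by linarith)
  have hpL : Icc (L₁ + δ) L ⊆ Icc 0 L := Icc_subset_Icc_left (by linarith)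
  have hw' : ∀ x ∈ Ioo 0 L, HasDerivAt w (φ x / r x) x := by
    intro x hx
    have hrx := (hrpos x (Ioo_subset_Icc_self hx)).ne'
    refine ((hderiv hu₂ x hx).sub (hderiv hu₁ x hx)).congr_deriv ?_
    simp only [hφ_def, flux]
    field_simp
    ring
  have hwc : ContinuousOn w (Icc 0 L) := hu₂.continuousOn.sub hu₁.continuousOn
  have hφd : ∀ x ∈ Ioo 0 L,
      HasDerivAt φ (deriv (flux r c ν u₁) x - deriv (flux r c ν u₂) x) x := fun x hx =>
    (hflux hru₁ x hx).hasDerivAt.sub (hflux hru₂ x hx).hasDerivAt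
  have hφc : ContinuousOn φ (Ioo 0 L) := fun x hx =>
    (hφd x hx).continuousAt.continuousWithinAt
  have hpc : ∀ x ∈ Icc 0 L₁ ∪ Icc (L₁ + δ) L, ContinuousAt p x := fun x hx =>
    ((hv₂ x hx).2.sub (hv₁ x hx).2).continuousAt
  have hvc : ∀ x ∈ Icc 0 L₁ ∪ Icc (L₁ + δ) L, ContinuousAt (fun t => v₂ t - v₁ t) x :=
    fun x hx => ((hv₂ x hx).1.sub (hv₁ x hx).1).continuousAt
  have hy_eq : y = fun x => (v₂ x - v₁ x) - w x := by
    funext x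
    simp only [hy_def, hw_def]
    ring
  have hyc : ContinuousOn y (Icc 0 L₁) ∧ ContinuousOn y (Icc (L₁ + δ) L) := by
    rw [hy_eq]
    exact ⟨fun x hx => (hvc x (Or.inl hx)).continuousWithinAt.sub (hwc.mono hnL x hx),
      fun x hx => (hvc x (Or.inr hx)).continuousWithinAt.sub (hwc.mono hpL x hx)⟩
  have hpcn : ContinuousOn p (Icc 0 L₁) := fun x hx => (hpc x (Or.inl hx)).continuousWithinAt
  have hpcp : ContinuousOn p (Icc (L₁ + δ) L) :=
    fun x hx => (hpc x (Or.inr hx)).continuousWithinAt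
  have hy' : ∀ x ∈ Icc 0 L₁ ∪ Icc (L₁ + δ) L, x ∈ Ioo 0 L →
      HasDerivAt y (p x - φ x / r x) x := by
    intro x hx hx'
    rw [hy_eq]
    exact ((hv₂ x hx).1.hasDerivAt.sub (hv₁ x hx).1.hasDerivAt).sub (hw' x hx')
  have hp'n : ∀ x ∈ Ioo 0 L₁, HasDerivAt p (qm * bm x * D x) x := by
    intro x hx
    have hm : x ∈ Icc 0 L₁ ∪ Icc (L₁ + δ) L := Or.inl (Ioo_subset_Icc_self hx)
    refine ((hv₂ x hm).2.hasDerivAt.sub (hv₁ x hm).2.hasDerivAt).congr_deriv ?_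
    rw [hnv₁ x hx, hnv₂ x hx]
    ring
  have hp'p : ∀ x ∈ Ioo (L₁ + δ) L, HasDerivAt p (qp * bp x * D x) x := by
    intro x hx
    have hm : x ∈ Icc 0 L₁ ∪ Icc (L₁ + δ) L := Or.inr (Ioo_subset_Icc_self hx)
    refine ((hv₂ x hm).2.hasDerivAt.sub (hv₁ x hm).2.hasDerivAt).congr_deriv ?_
    rw [hpv₁ x hx, hpv₂ x hx]
    ring
  have hp0 : p 0 = 0 := by simp [hp_def, h0₁, h0₂]
  have hpi : p L₁ = 0 := by simp [hp_def, hi₁, hi₂]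
  have hpj : p (L₁ + δ) = 0 := by simp [hp_def, hj₁, hj₂]
  have hpe : p L = 0 := by simp [hp_def, he₁, he₂]
  -- The total current `φ + κ p` is the same constant throughout the cell.
  have hφn : ∀ x ∈ Ioc 0 L₁, φ x = φ L₁ - km / qm * p x := by
    intro x hx
    have hsub : Icc x L₁ ⊆ Ioo 0 L :=
      fun t ht => ⟨hx.1.trans_le ht.1, by linarith [ht.2]⟩
    have := eq_of_hasDerivAt_zero (g := fun t => φ t + km / qm * p t) hx.2
      ((hφc.mono hsub).add ((hpcn.mono (Icc_subset_Icc_left hx.1.le)).const_mul _)) (by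
        intro t ht
        have ht' : t ∈ Ioo 0 L₁ := ⟨hx.1.trans ht.1, ht.2⟩
        refine ((hφd t (hsub (Ioo_subset_Icc_self ht))).add
          ((hp'n t ht').const_mul (km / qm))).congr_deriv ?_
        rw [hnu₁ t ht', hnu₂ t ht']
        simp only [hD_def]
        field_simp
        ring)
    simp only [hpi] at this
    linarith
  have hφs : ∀ x ∈ Icc L₁ (L₁ + δ), φ x = φ L₁ := by
    intro x hx
    have hsub : Icc L₁ x ⊆ Ioo 0 L :=
      fun t ht => ⟨hL₁.trans_le ht.1, by linarith [ht.2, hx.2]⟩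
    refine (eq_of_hasDerivAt_zero hx.1 (hφc.mono hsub) ?_).symm
    intro t ht
    have ht' : t ∈ Ioo L₁ (L₁ + δ) := ⟨ht.1, ht.2.trans_le hx.2⟩
    refine (hφd t (hsub (Ioo_subset_Icc_self ht))).congr_deriv ?_
    rw [hsu₁ t ht', hsu₂ t ht', sub_zero]
  have hφp : ∀ x ∈ Ico (L₁ + δ) L, φ x = φ L₁ - kp / qp * p x := by
    intro x hx
    have hsub : Icc (L₁ + δ) x ⊆ Ioo 0 L :=
      fun t ht => ⟨by linarith [ht.1], ht.2.trans_lt hx.2⟩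
    have := eq_of_hasDerivAt_zero (g := fun t => φ t + kp / qp * p t) hx.1
      ((hφc.mono hsub).add ((hpcp.mono (Icc_subset_Icc_right hx.2.le)).const_mul _)) (by
        intro t ht
        have ht' : t ∈ Ioo (L₁ + δ) L := ⟨ht.1, ht.2.trans hx.2⟩
        refine ((hφd t (hsub (Ioo_subset_Icc_self ht))).add
          ((hp'p t ht').const_mul (kp / qp))).congr_deriv ?_
        rw [hpu₁ t ht', hpu₂ t ht']
        simp only [hD_def]
        field_simp
        ring)
    simp only [hpj, hφs _ (right_mem_Icc.2 (by linarith : L₁ ≤ L₁ + δ))] at this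
    linarith
  -- Differentiability of the flux at the interface forces the reaction term to vanish there.
  have hL₁m : L₁ ∈ Icc 0 L₁ := right_mem_Icc.2 hL₁.le
  have hinterface : ∀ {u v : ℝ → ℝ}, ContDiffOn ℝ 1 u (Icc 0 L) →
      DifferentiableOn ℝ (fun y => r y * deriv u y) (Ioo 0 L) → ContinuousAt v L₁ →
      (∀ x ∈ Ioo 0 L₁, deriv (flux r c ν u) x = km * bm x * E a b f x (v x - u x)) →
      (∀ x ∈ Ioo L₁ (L₁ + δ), deriv (flux r c ν u) x = 0) →
      E a b f L₁ (v L₁ - u L₁) = 0 := by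
    intro u v hu hru hv hn hs
    have huc : ContinuousWithinAt u (Ioo 0 L₁) L₁ :=
      (hu.continuousOn L₁ (hnL hL₁m)).mono (Ioo_subset_Icc_self.trans hnL)
    have hbc : ContinuousWithinAt bm (Ioo 0 L₁) L₁ := (hbm L₁ hL₁m).mono Ioo_subset_Icc_self
    have hwf : ContinuousWithinAt (fun x => v x - u x - f x) (Ioo 0 L₁) L₁ :=
      (hv.continuousWithinAt.sub huc).sub hf.continuousWithinAt
    have hE : ContinuousWithinAt (fun x => E a b f x (v x - u x)) (Ioo 0 L₁) L₁ :=
      (continuousWithinAt_const.mul hwf).rexp.sub (continuousWithinAt_const.mul hwf).rexp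
    have := eq_zero_of_deriv_interface (F := flux r c ν u)
      (S := fun x => km * bm x * E a b f x (v x - u x)) hL₁ (by linarith : L₁ < L₁ + δ)
      (fun x hx => hflux hru x ⟨hx.1, hx.2.trans hL⟩) hn hs
      ((continuousWithinAt_const.mul hbc).mul hE)
    simpa [hkm.ne', (hbmpos L₁ hL₁m).ne'] using this
  have hyi : y L₁ = 0 := by
    have e₁ := hinterface hu₁ hru₁ (hv₁ L₁ (Or.inl hL₁m)).1.continuousAt hnu₁ hsu₁
    have e₂ := hinterface hu₂ hru₂ (hv₂ L₁ (Or.inl hL₁m)).1.continuousAt hnu₂ hsu₂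
    exact sub_eq_zero.2 ((E_strictMono ha hb f L₁).injective (e₂.trans e₁.symm))
  have hy'n : ∀ x ∈ Ioo 0 L₁,
      HasDerivAt y (p x - (φ L₁ - km / qm * p x) / r x) x := by
    intro x hx
    rw [← hφn x ⟨hx.1, hx.2.le⟩]
    exact hy' x (Or.inl (Ioo_subset_Icc_self hx)) ⟨hx.1, by linarith [hx.2]⟩
  have hrn : ContinuousOn r (Icc 0 L₁) := hr.continuousOn.mono hnL
  have hqb : ∀ x ∈ Ioo 0 L₁, 0 < qm * bm x :=
    fun x hx => mul_pos hqm (hbmpos x (Ioo_subset_Icc_self hx))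
  have hA : φ L₁ = 0 := by
    refine le_antisymm (not_lt.1 ?_) (not_lt.1 fun hneg => ?_)
    · exact not_pos_of_boundary_zero hL₁ (div_pos hkm hqm) hpcn hyc.1 hrn
        (fun x hx => hrpos x (hnL hx)) hp'n hy'n
        (fun x hx hpos => mul_pos (hqb x hx) (hDpos x hpos)) hp0 hpi hyi
    · refine not_pos_of_boundary_zero (A := -φ L₁) hL₁ (div_pos hkm hqm) hpcn.neg hyc.1.neg hrn
        (fun x hx => hrpos x (hnL hx)) (fun x hx => (hp'n x hx).neg) (fun x hx => ?_)
        (fun x hx hpos => ?_) (by simp [hp0]) (by simp [hpi]) (by simp [hyi]) (neg_pos.2 hneg)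
      · refine (hy'n x hx).neg.congr_deriv ?_
        simp only [Pi.neg_apply]
        ring
      · have := mul_neg_of_pos_of_neg (hqb x hx) (hDneg x (neg_pos.1 hpos))
        linarith
  obtain ⟨hpn, hyn⟩ := eqOn_zero_of_energy (m := fun x => 1 + km / qm / r x) hL₁ hpcn hyc.1 hp'n
    (fun x hx => (hy'n x hx).congr_deriv (by rw [hA]; ring))
    (fun x hx => by
      have := hrpos x (hnL (Ioo_subset_Icc_self hx))
      positivity)
    (fun x hx h0 => by
      rw [mul_assoc]
      exact mul_pos (hqb x hx) (hDy x h0)) hp0 hpi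
  obtain ⟨hpp, hyp⟩ := eqOn_zero_of_energy (m := fun x => 1 + kp / qp / r x) hL hpcp hyc.2 hp'p
    (fun x hx => (hy' x (Or.inr (Ioo_subset_Icc_self hx))
      ⟨by linarith [hx.1], hx.2⟩).congr_deriv (by
        rw [hφp x ⟨hx.1.le, hx.2⟩, hA]
        ring))
    (fun x hx => by
      have := hrpos x (hpL (Ioo_subset_Icc_self hx))
      positivity)
    (fun x hx h0 => by
      rw [mul_assoc]
      exact mul_pos (mul_pos hqp (hbppos x (Ioo_subset_Icc_self hx))) (hDy x h0)) hpj hpe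
  have hφ0 : ∀ x ∈ Ioo 0 L, φ x = 0 := by
    intro x hx
    rcases le_or_gt x L₁ with h | h
    · simp [hφn x ⟨hx.1, h⟩, hA, hpn ⟨hx.1.le, h⟩]
    rcases le_or_gt x (L₁ + δ) with h' | h'
    · rw [hφs x ⟨h.le, h'⟩, hA]
    · simp [hφp x ⟨h'.le, hx.2⟩, hA, hpp ⟨h'.le, hx.2.le⟩]
  have hwconst : ∀ x ∈ Icc 0 L, w x = w 0 := by
    intro x hx
    refine (eq_of_hasDerivAt_zero hx.1 (hwc.mono (Icc_subset_Icc_right hx.2)) ?_).symm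
    intro t ht
    have ht' : t ∈ Ioo 0 L := ⟨ht.1, ht.2.trans_le hx.2⟩
    exact (hw' t ht').congr_deriv (by rw [hφ0 t ht', zero_div])
  have hvw : ∀ x, y x = 0 → v₂ x - v₁ x = w x := by
    intro x hx
    simp only [hy_eq] at hx
    linarith
  exact ⟨w 0, hwconst, fun x hx => (hvw x (hyn hx)).trans (hwconst x (hnL hx)),
    fun x hx => (hvw x (hyp hx)).trans (hwconst x (hpL hx))⟩
end

section
/- (Uniqueness for the linearized system with a reference potential.) If (u₁,v₁) and (u₂,v₂) are two classical solutions of the linearized system (P_lin) that additionally satisfy v₁(0) = 0 and v₂(0) = 0, then u₁ = u₂ on [0,L] and v₁ = v₂ on [0,L₁] ∪ [L₁+δ, L]. -/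
open Set MeasureTheory intervalIntegral

/-- A classical solution `(u, v)` of the system. -/
def IsSolutionLin (L₁ δ L ν dm dp lm lp tm tp : ℝ)
    (f r c bm bp u v : ℝ → ℝ) : Prop :=
  -- `u` is continuously differentiable on `[0, L]`
  ContDiffOn ℝ 1 u (Icc 0 L) ∧
  -- `r·u′` is differentiable on `(0, L)`
  DifferentiableOn ℝ (fun y => r y * deriv u y) (Ioo 0 L) ∧
  -- `v` is twice differentiable on `[0, L₁]` and on `[L₁+δ, L]`
  (∀ x ∈ Icc 0 L₁ ∪ Icc (L₁ + δ) L,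
      DifferentiableAt ℝ v x ∧ DifferentiableAt ℝ (deriv v) x) ∧
  -- electrolyte-potential equation on the negative electrode
  (∀ x ∈ Ioo 0 L₁, deriv (flux r c ν u) x = lm * bm x * (v x - u x - f x)) ∧
  -- electrolyte-potential equation on the separator
  (∀ x ∈ Ioo L₁ (L₁ + δ), deriv (flux r c ν u) x = 0) ∧
  -- electrolyte-potential equation on the positive electrode
  (∀ x ∈ Ioo (L₁ + δ) L, deriv (flux r c ν u) x = lp * bp x * (v x - u x - f x)) ∧
  -- boundary conditions for `u`
  deriv u 0 = 0 ∧ deriv u L = 0 ∧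
  -- solid-potential equation on the negative electrode (`−v″ = −(⋯)`)
  (∀ x ∈ Ioo 0 L₁, deriv (deriv v) x = tm * bm x * (v x - u x - f x)) ∧
  -- solid-potential equation on the positive electrode (`−v″ = −(⋯)`)
  (∀ x ∈ Ioo (L₁ + δ) L, deriv (deriv v) x = tp * bp x * (v x - u x - f x)) ∧
  -- boundary conditions for `v`: `−v′(0) = d₋`, `v′(L) = −d₊`, `v′(L₁) = v′(L₁+δ) = 0`
  deriv v 0 = -dm ∧ deriv v L = -dp ∧ deriv v L₁ = 0 ∧ deriv v (L₁ + δ) = 0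

/-- A function continuous on `[a, b]` whose derivative vanishes on `(a, b)` is constant. -/
lemma eq_left_of_hasDerivAt_zero {a b : ℝ} {g : ℝ → ℝ} (hg : ContinuousOn g (Icc a b))
    (hg' : ∀ x ∈ Ioo a b, HasDerivAt g 0 x) : ∀ x ∈ Icc a b, g x = g a := by
  intro x hx
  rcases eq_or_lt_of_le hx.1 with h | h
  · rw [h]
  · obtain ⟨y, -, hy⟩ := exists_hasDerivAt_eq_slope g (fun _ => 0) h
      (hg.mono (Icc_subset_Icc_right hx.2)) (fun y hy => hg' y ⟨hy.1, hy.2.trans_le hx.2⟩)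
    have : x - a ≠ 0 := by linarith
    field_simp at hy
    linarith

/-- If `y' = β s` with `β > 0`, `s` vanishes at `p` and `s'` is negative near `p`, then `y` takes
smaller values than `y p` to the left of `p`. -/
lemma exists_lt_of_deriv_neg {a b p : ℝ} {β y s g r : ℝ → ℝ} (hp : p ∈ Ioc a b)
    (hβ : ∀ x ∈ Ioo a b, 0 < β x) (hr : ∀ x ∈ Icc a b, 0 < r x)
    (hy : ContinuousOn y (Icc a b)) (hs : ContinuousOn s (Icc a b))
    (hg : ContinuousOn g (Icc a b))
    (hy' : ∀ x ∈ Ioo a b, HasDerivAt y (β x * s x) x)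
    (hs' : ∀ x ∈ Ioo a b, HasDerivAt s (g x / r x) x)
    (hsp : s p = 0) (hgp : g p < 0) : ∃ x ∈ Icc a b, y x < y p := by
  have hpI : p ∈ Icc a b := ⟨hp.1.le, hp.2⟩
  have hev : ∀ᶠ x in nhdsWithin p (Icc a b), g x < 0 := (hg p hpI).eventually_lt_const hgp
  obtain ⟨ε, hε, hball⟩ := Metric.mem_nhdsWithin_iff.1 hev
  obtain ⟨q, hq, hqp⟩ := exists_between (max_lt hp.1 (sub_lt_self p hε))
  have hqa : a < q := (le_max_left _ _).trans_lt hq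
  have hqε : p - ε < q := (le_max_right _ _).trans_lt hq
  have hsub : Icc q p ⊆ Icc a b := Icc_subset_Icc hqa.le hp.2
  have hsubo : Ioo q p ⊆ Ioo a b := Ioo_subset_Ioo hqa.le hp.2
  have hneg : ∀ x ∈ Ioo q p, g x < 0 := fun x hx => by
    refine hball ⟨?_, hsub ⟨hx.1.le, hx.2.le⟩⟩
    rw [Metric.mem_ball, Real.dist_eq, abs_lt]
    constructor <;> linarith [hx.1, hx.2]
  have hanti : StrictAntiOn s (Icc q p) := by
    refine strictAntiOn_of_deriv_neg (convex_Icc _ _) (hs.mono hsub) fun x hx => ?_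
    rw [interior_Icc] at hx
    rw [(hs' x (hsubo hx)).deriv]
    exact div_neg_of_neg_of_pos (hneg x hx) (hr x (hsub ⟨hx.1.le, hx.2.le⟩))
  have hmono : StrictMonoOn y (Icc q p) := by
    refine strictMonoOn_of_deriv_pos (convex_Icc _ _) (hy.mono hsub) fun x hx => ?_
    rw [interior_Icc] at hx
    rw [(hy' x (hsubo hx)).deriv]
    refine mul_pos (hβ x (hsubo hx)) ?_
    rw [← hsp]
    exact hanti ⟨hx.1.le, hx.2.le⟩ ⟨hqp.le, le_rfl⟩ hx.2
  exact ⟨q, hsub ⟨le_rfl, hqp.le⟩, hmono ⟨le_rfl, hqp.le⟩ ⟨hqp.le, le_rfl⟩ hqp⟩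

/-- A minimum principle for `y' = β s`, `s' = (y (r + μ) - K) / r` with `y a = y b = 0`
and `K ≥ 0`. -/
lemma nonneg_of_system {a b K μ : ℝ} {β y s r : ℝ → ℝ} (hab : a < b) (hμ : 0 < μ)
    (hβ : ∀ x ∈ Ioo a b, 0 < β x) (hr : ∀ x ∈ Icc a b, 0 < r x)
    (hrc : ContinuousOn r (Icc a b))
    (hy : ContinuousOn y (Icc a b)) (hs : ContinuousOn s (Icc a b))
    (hy' : ∀ x ∈ Ioo a b, HasDerivAt y (β x * s x) x)
    (hs' : ∀ x ∈ Ioo a b, HasDerivAt s ((y x * (r x + μ) - K) / r x) x)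
    (hya : y a = 0) (hyb : y b = 0) (hK : 0 ≤ K) (hKs : K = 0 ∨ s b = 0) :
    K = 0 ∧ ∀ x ∈ Icc a b, 0 ≤ y x := by
  have hg : ContinuousOn (fun x => y x * (r x + μ) - K) (Icc a b) := by fun_prop
  obtain ⟨p, hp, hmin⟩ := isCompact_Icc.exists_isMinOn (nonempty_Icc.2 hab.le) hy
  have hmin' : ∀ x ∈ Icc a b, y p ≤ y x := fun x hx => hmin hx
  have hyp : y p ≤ 0 := hya ▸ hmin' a ⟨le_rfl, hab.le⟩
  have key : ∀ q ∈ Ioc a b, y q = y p → s q = 0 → 0 ≤ y q * (r q + μ) - K := by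
    intro q hq hqp hsq
    by_contra! h
    obtain ⟨x, hx, hlt⟩ := exists_lt_of_deriv_neg hq hβ hr hy hs hg hy' hs' hsq h
    exact absurd (hmin' x hx) (by rw [← hqp]; exact not_le.2 hlt)
  have hint : p ∈ Ioo a b → s p = 0 := fun h => by
    have hloc : IsLocalMin y p := hmin.isLocalMin (Icc_mem_nhds h.1 h.2)
    have := hloc.hasDerivAt_eq_zero (hy' p h)
    exact (mul_eq_zero.1 this).resolve_left (hβ p h).ne'
  by_cases h : p ∈ Ioo a b
  · have h1 := key p ⟨h.1, h.2.le⟩ rfl (hint h)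
    have hrp := hr p hp
    have hy0 : y p = 0 := by
      refine le_antisymm hyp ?_
      by_contra! hneg
      nlinarith [mul_neg_of_neg_of_pos hneg (add_pos hrp hμ)]
    rw [hy0] at h1 hmin'
    exact ⟨by linarith, hmin'⟩
  · have hy0 : y p = 0 := by
      rcases eq_or_lt_of_le hp.1 with h1 | h1
      · rw [← h1, hya]
      · rcases eq_or_lt_of_le hp.2 with h2 | h2
        · rw [h2, hyb]
        · exact absurd ⟨h1, h2⟩ h
    refine ⟨?_, fun x hx => hy0 ▸ hmin' x hx⟩
    rcases hKs with h0 | h0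
    · exact h0
    · have h1 := key b ⟨hab, le_rfl⟩ (hyb.trans hy0.symm) h0
      rw [hyb] at h1
      linarith

/-- Under Dirichlet conditions on `y`, the system `y' = β s`, `s' = (y (r + μ) - K) / r` with
`K = 0` or `s b = 0` has only the solution `y = 0`, and forces `K = 0`. -/
lemma eq_zero_of_system {a b K μ : ℝ} {β y s r : ℝ → ℝ} (hab : a < b) (hμ : 0 < μ)
    (hβ : ∀ x ∈ Ioo a b, 0 < β x) (hr : ∀ x ∈ Icc a b, 0 < r x)
    (hrc : ContinuousOn r (Icc a b))
    (hy : ContinuousOn y (Icc a b)) (hs : ContinuousOn s (Icc a b))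
    (hy' : ∀ x ∈ Ioo a b, HasDerivAt y (β x * s x) x)
    (hs' : ∀ x ∈ Ioo a b, HasDerivAt s ((y x * (r x + μ) - K) / r x) x)
    (hya : y a = 0) (hyb : y b = 0) (hKs : K = 0 ∨ s b = 0) :
    K = 0 ∧ ∀ x ∈ Icc a b, y x = 0 := by
  have hpos : 0 ≤ K → K = 0 ∧ ∀ x ∈ Icc a b, 0 ≤ y x := fun hK =>
    nonneg_of_system hab hμ hβ hr hrc hy hs hy' hs' hya hyb hK hKs
  have hneg : K ≤ 0 → K = 0 ∧ ∀ x ∈ Icc a b, y x ≤ 0 := fun hK => by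
    have := nonneg_of_system (K := -K) (y := fun x => -y x) (s := fun x => -s x) hab hμ hβ hr hrc
      hy.neg hs.neg
      (fun x hx => (hy' x hx).neg.congr_deriv (by ring))
      (fun x hx => (hs' x hx).neg.congr_deriv (by ring))
      (by simp [hya]) (by simp [hyb]) (by linarith)
      (hKs.imp (fun h => by simp [h]) (fun h => by simp [h]))
    exact ⟨by linarith [this.1], fun x hx => by linarith [this.2 x hx]⟩
  have hK : K = 0 := (le_total 0 K).elim (fun h => (hpos h).1) (fun h => (hneg h).1)
  exact ⟨hK, fun x hx => le_antisymm ((hneg hK.le).2 x hx) ((hpos hK.ge).2 x hx)⟩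

/-- On an electrode `[a, b]`: let `z'` vanish at both ends, `z'' = θ β (z - w)` and
`(r w')' = -λ β (z - w)` with flux `F = r w'`. If the constant `F + (λ/θ) z'` vanishes or
`z = w` at `b`, then that constant is zero, `z' = 0` and `z = w`. -/
lemma electrode_trivial {a b lam θ K : ℝ} {β r F w w' z z' : ℝ → ℝ} (hab : a < b)
    (hlam : 0 < lam) (hθ : 0 < θ)
    (hβ : ∀ x ∈ Icc a b, 0 < β x) (hr : ∀ x ∈ Icc a b, 0 < r x)
    (hrc : ContinuousOn r (Icc a b)) (hwc : ContinuousOn w (Icc a b))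
    (hz : ∀ x ∈ Icc a b, HasDerivAt z (z' x) x)
    (hz'c : ContinuousOn z' (Icc a b))
    (hz' : ∀ x ∈ Ioo a b, HasDerivAt z' (θ * β x * (z x - w x)) x)
    (hw : ∀ x ∈ Ioo a b, HasDerivAt w (w' x) x)
    (hF : ∀ x ∈ Ioo a b, F x = r x * w' x)
    (hFz : ∀ x ∈ Ioo a b, F x + lam / θ * z' x = K)
    (hza : z' a = 0) (hzb : z' b = 0) (hK : K = 0 ∨ z b - w b = 0) :
    K = 0 ∧ (∀ x ∈ Icc a b, z' x = 0) ∧ ∀ x ∈ Icc a b, z x = w x := by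
  have hzc : ContinuousOn z (Icc a b) := fun x hx => (hz x hx).continuousAt.continuousWithinAt
  have hsc : ContinuousOn (fun x => z x - w x) (Icc a b) := hzc.sub hwc
  obtain ⟨h1, h2⟩ := eq_zero_of_system (K := K) (μ := lam / θ) (β := fun x => θ * β x) (y := z')
    (s := fun x => z x - w x) (r := r) hab (div_pos hlam hθ)
    (fun x hx => mul_pos hθ (hβ x (Ioo_subset_Icc_self hx))) hr hrc hz'c hsc hz'
    (fun x hx => by
      have hx' := Ioo_subset_Icc_self hx
      refine ((hz x hx').sub (hw x hx)).congr_deriv ?_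
      have h := hFz x hx
      rw [hF x hx] at h
      have := (hr x hx').ne'
      rw [← h]
      field_simp
      ring) hza hzb hK
  refine ⟨h1, h2, ?_⟩
  have hin : EqOn (fun x => z x - w x) (fun _ => 0) (Ioo a b) := fun x hx => by
    have h0 : HasDerivAt z' 0 x := by
      refine (hasDerivAt_const x (0 : ℝ)).congr_of_eventuallyEq ?_
      filter_upwards [Icc_mem_nhds hx.1 hx.2] with t ht using h2 t ht
    have h3 := (hz' x hx).unique h0
    exact (mul_eq_zero.1 h3).resolve_left (mul_pos hθ (hβ x (Ioo_subset_Icc_self hx))).ne'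
  have hcl := hin.of_subset_closure hsc continuousOn_const Ioo_subset_Icc_self
    (closure_Ioo hab.ne).ge
  exact fun x hx => sub_eq_zero.1 (hcl hx)

/-- If `F` is differentiable at `b`, constant on `[b, c]`, and has derivative `e` on `(a, b)`
with `e` continuous on `[a, b]`, then `e b = 0`. -/
lemma eq_zero_of_hasDerivAt_of_const_right {a b c : ℝ} {F e : ℝ → ℝ} (hab : a < b) (hbc : b < c)
    (hF : DifferentiableAt ℝ F b) (hconst : ∀ x ∈ Icc b c, F x = F b)
    (hF' : ∀ x ∈ Ioo a b, HasDerivAt F (e x) x) (he : ContinuousOn e (Icc a b)) : e b = 0 := by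
  have h0 : deriv F b = 0 := by
    have h1 : HasDerivWithinAt F 0 (Icc b c) b :=
      (hasDerivWithinAt_const b (Icc b c) (F b)).congr hconst rfl
    exact (uniqueDiffOn_Icc hbc b ⟨le_rfl, hbc.le⟩).eq_deriv _ hF.hasDerivAt.hasDerivWithinAt h1
  have hlim : Filter.Tendsto (deriv F) (nhdsWithin b (Iio b)) (nhds (e b)) := by
    have h1 : Filter.Tendsto e (nhdsWithin b (Ioo a b)) (nhds (e b)) :=
      (he b ⟨hab.le, le_rfl⟩).mono_left (nhdsWithin_mono _ Ioo_subset_Icc_self)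
    rw [nhdsWithin_Ioo_eq_nhdsLT hab] at h1
    refine h1.congr' ?_
    filter_upwards [Ioo_mem_nhdsLT hab] with x hx using (hF' x hx).deriv.symm
  have h2 : HasDerivWithinAt F (e b) (Iic b) b :=
    hasDerivWithinAt_Iic_of_tendsto_deriv (s := Ioo a b)
      (fun x hx => (hF' x hx).differentiableAt.differentiableWithinAt)
      hF.continuousAt.continuousWithinAt (Ioo_mem_nhdsLT hab) hlim
  rw [← h0]
  exact (uniqueDiffOn_Iic b b self_mem_Iic).eq_deriv _ h2 hF.hasDerivAt.hasDerivWithinAt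

theorem uniqueness_with_reference_lin (L₁ δ L ν dm dp lm lp tm tp : ℝ) (f r c bm bp : ℝ → ℝ) (u₁ v₁ u₂ v₂ : ℝ → ℝ)
    (hL₁ : 0 < L₁) (hδ : 0 < δ) (hL : L₁ + δ < L)
    (hf : Continuous f)
    (hr : ContDiffOn ℝ 1 r (Icc 0 L)) (hrpos : ∀ x ∈ Icc 0 L, 0 < r x)
    (hc : ContDiffOn ℝ 1 c (Icc 0 L)) (hcpos : ∀ x ∈ Icc 0 L, 0 < c x)
    (hc0 : deriv c 0 = 0) (hcL : deriv c L = 0)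
    (hrlc : DifferentiableOn ℝ (fun y => r y * deriv c y / c y) (Ioo 0 L))
    (hbm : ContinuousOn bm (Icc 0 L₁)) (hbmpos : ∀ x ∈ Icc 0 L₁, 0 < bm x)
    (hbp : ContinuousOn bp (Icc (L₁ + δ) L)) (hbppos : ∀ x ∈ Icc (L₁ + δ) L, 0 < bp x)
    (hlm : 0 < lm) (hlp : 0 < lp) (htm : 0 < tm) (htp : 0 < tp)
    (hsol₁ : IsSolutionLin L₁ δ L ν dm dp lm lp tm tp f r c bm bp u₁ v₁)
    (hsol₂ : IsSolutionLin L₁ δ L ν dm dp lm lp tm tp f r c bm bp u₂ v₂)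
    (hv₁ : v₁ 0 = 0) (hv₂ : v₂ 0 = 0) :
    (∀ x ∈ Icc (0:ℝ) L, u₁ x = u₂ x) ∧
      (∀ x ∈ Icc (0:ℝ) L₁ ∪ Icc (L₁ + δ) L, v₁ x = v₂ x) := by
  obtain ⟨hu₁, hru₁, hdv₁, heqm₁, heqs₁, heqp₁, -, -, hvm₁, hvp₁, hb0₁, hbL₁, hbm₁, hbp₁⟩ := hsol₁
  obtain ⟨hu₂, hru₂, hdv₂, heqm₂, heqs₂, heqp₂, -, -, hvm₂, hvp₂, hb0₂, hbL₂, hbm₂, hbp₂⟩ := hsol₂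
  set F : ℝ → ℝ := fun x => flux r c ν u₂ x - flux r c ν u₁ x with hFdef
  set w : ℝ → ℝ := fun x => u₁ x - u₂ x with hwdef
  set w' : ℝ → ℝ := fun x => deriv u₁ x - deriv u₂ x with hw'def
  set z : ℝ → ℝ := fun x => v₁ x - v₂ x with hzdef
  set z' : ℝ → ℝ := fun x => deriv v₁ x - deriv v₂ x with hz'def
  have hFw : ∀ x, F x = r x * w' x := fun x => by simp only [hFdef, hw'def, flux]; ring
  have hflux : ∀ u : ℝ → ℝ, DifferentiableOn ℝ (fun y => r y * deriv u y) (Ioo 0 L) →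
      ∀ x ∈ Ioo 0 L, DifferentiableAt ℝ (flux r c ν u) x := fun u hu x hx => by
    have hx' := Ioo_mem_nhds hx.1 hx.2
    exact ((hu.differentiableAt hx').neg).add ((hrlc.differentiableAt hx').const_mul ν)
  have hF' : ∀ x ∈ Ioo 0 L,
      HasDerivAt F (deriv (flux r c ν u₂) x - deriv (flux r c ν u₁) x) x := fun x hx =>
    (hflux u₂ hru₂ x hx).hasDerivAt.sub (hflux u₁ hru₁ x hx).hasDerivAt
  have hFc : ∀ x ∈ Ioo 0 L, ContinuousAt F x := fun x hx => (hF' x hx).continuousAt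
  have hwc : ContinuousOn w (Icc 0 L) := hu₁.continuousOn.sub hu₂.continuousOn
  have hw : ∀ x ∈ Ioo 0 L, HasDerivAt w (w' x) x := fun x hx => by
    have hx' := Icc_mem_nhds hx.1 hx.2
    exact ((hu₁.differentiableOn one_ne_zero).differentiableAt hx').hasDerivAt.sub
      ((hu₂.differentiableOn one_ne_zero).differentiableAt hx').hasDerivAt
  have hz : ∀ x ∈ Icc 0 L₁ ∪ Icc (L₁ + δ) L, HasDerivAt z (z' x) x := fun x hx =>
    (hdv₁ x hx).1.hasDerivAt.sub (hdv₂ x hx).1.hasDerivAt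
  have hz' : ∀ x ∈ Icc 0 L₁ ∪ Icc (L₁ + δ) L,
      HasDerivAt z' (deriv (deriv v₁) x - deriv (deriv v₂) x) x := fun x hx =>
    (hdv₁ x hx).2.hasDerivAt.sub (hdv₂ x hx).2.hasDerivAt
  have hz'c : ∀ x ∈ Icc 0 L₁ ∪ Icc (L₁ + δ) L, ContinuousAt z' x := fun x hx =>
    (hz' x hx).continuousAt
  have hsubm : Icc 0 L₁ ⊆ Icc 0 L := Icc_subset_Icc_right (by linarith)
  have hsubp : Icc (L₁ + δ) L ⊆ Icc 0 L := Icc_subset_Icc_left (by linarith)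
  have hz'm : ∀ x ∈ Ioo 0 L₁, HasDerivAt z' (tm * bm x * (z x - w x)) x := fun x hx => by
    convert hz' x (Or.inl (Ioo_subset_Icc_self hx)) using 1
    rw [hvm₁ x hx, hvm₂ x hx]; simp only [hzdef, hwdef]; ring
  have hz'p : ∀ x ∈ Ioo (L₁ + δ) L, HasDerivAt z' (tp * bp x * (z x - w x)) x := fun x hx => by
    convert hz' x (Or.inr (Ioo_subset_Icc_self hx)) using 1
    rw [hvp₁ x hx, hvp₂ x hx]; simp only [hzdef, hwdef]; ring
  have hFm : ∀ x ∈ Ioo 0 L₁, HasDerivAt F (-(lm * bm x * (z x - w x))) x := fun x hx => by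
    convert hF' x ⟨hx.1, by linarith [hx.2]⟩ using 1
    rw [heqm₁ x hx, heqm₂ x hx]; simp only [hzdef, hwdef]; ring
  have hFp : ∀ x ∈ Ioo (L₁ + δ) L, HasDerivAt F (-(lp * bp x * (z x - w x))) x := fun x hx => by
    convert hF' x ⟨by linarith [hx.1], hx.2⟩ using 1
    rw [heqp₁ x hx, heqp₂ x hx]; simp only [hzdef, hwdef]; ring
  have hFs : ∀ x ∈ Icc L₁ (L₁ + δ), F x = F L₁ := by
    refine eq_left_of_hasDerivAt_zero
      (fun x hx => (hFc x ⟨by linarith [hx.1], by linarith [hx.2]⟩).continuousWithinAt)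
      fun x hx => ?_
    convert hF' x ⟨by linarith [hx.1], by linarith [hx.2]⟩ using 1
    rw [heqs₁ x hx, heqs₂ x hx, sub_zero]
  have hz'0 : z' 0 = 0 := by simp [hz'def, hb0₁, hb0₂]
  have hz'L : z' L = 0 := by simp [hz'def, hbL₁, hbL₂]
  have hz'L₁ : z' L₁ = 0 := by simp [hz'def, hbm₁, hbm₂]
  have hz'L₂ : z' (L₁ + δ) = 0 := by simp [hz'def, hbp₁, hbp₂]
  have hz0 : z 0 = 0 := by simp [hzdef, hv₁, hv₂]
  have hzcm : ContinuousOn z (Icc 0 L₁) := fun x hx =>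
    (hz x (Or.inl hx)).continuousAt.continuousWithinAt
  have hsL₁ : z L₁ - w L₁ = 0 := by
    have h := eq_zero_of_hasDerivAt_of_const_right (e := fun x => -(lm * bm x * (z x - w x)))
      hL₁ (by linarith : L₁ < L₁ + δ) (hF' L₁ ⟨hL₁, by linarith⟩).differentiableAt hFs hFm
      ((continuousOn_const.mul hbm).mul (hzcm.sub (hwc.mono hsubm))).neg
    have hb := hbmpos L₁ ⟨hL₁.le, le_rfl⟩
    exact (mul_eq_zero.1 (neg_eq_zero.1 h)).resolve_left (mul_pos hlm hb).ne'
  have hFzm : ∀ x ∈ Ioo 0 L₁, F x + lm / tm * z' x = F L₁ := fun x hx => by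
    have h := eq_left_of_hasDerivAt_zero (a := x) (b := L₁) (g := fun t => F t + lm / tm * z' t)
      (fun t ht => ((hFc t ⟨by linarith [hx.1, ht.1], by linarith [ht.2]⟩).add
        (continuousAt_const.mul (hz'c t (Or.inl ⟨hx.1.le.trans ht.1, ht.2⟩)))).continuousWithinAt)
      (fun t ht => by
        have ht' : t ∈ Ioo 0 L₁ := ⟨hx.1.trans ht.1, ht.2⟩
        refine ((hFm t ht').add ((hz'm t ht').const_mul (lm / tm))).congr_deriv ?_
        field_simp
        ring) L₁ ⟨hx.2.le, le_rfl⟩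
    simp only [hz'L₁, mul_zero, add_zero] at h
    exact h.symm
  obtain ⟨hFL₁, hz'm0, hzwm⟩ := electrode_trivial (r := r) (F := F) hL₁ hlm htm hbmpos
    (fun x hx => hrpos x (hsubm hx)) (hr.continuousOn.mono hsubm) (hwc.mono hsubm)
    (fun x hx => hz x (Or.inl hx)) (fun x hx => (hz'c x (Or.inl hx)).continuousWithinAt) hz'm
    (fun x hx => hw x ⟨hx.1, by linarith [hx.2]⟩) (fun x _ => hFw x) hFzm hz'0 hz'L₁ (Or.inr hsL₁)
  have hFL₂ : F (L₁ + δ) = 0 := by rw [hFs _ ⟨by linarith, le_rfl⟩, hFL₁]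
  have hFzp : ∀ x ∈ Ioo (L₁ + δ) L, F x + lp / tp * z' x = 0 := fun x hx => by
    have h := eq_left_of_hasDerivAt_zero (a := L₁ + δ) (b := x)
      (g := fun t => F t + lp / tp * z' t)
      (fun t ht => ((hFc t ⟨by linarith [ht.1], by linarith [hx.2, ht.2]⟩).add
        (continuousAt_const.mul (hz'c t (Or.inr ⟨ht.1, ht.2.trans hx.2.le⟩)))).continuousWithinAt)
      (fun t ht => by
        have ht' : t ∈ Ioo (L₁ + δ) L := ⟨ht.1, ht.2.trans hx.2⟩
        refine ((hFp t ht').add ((hz'p t ht').const_mul (lp / tp))).congr_deriv ?_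
        field_simp
        ring) x ⟨hx.1.le, le_rfl⟩
    simpa only [hz'L₂, hFL₂, mul_zero, add_zero] using h
  obtain ⟨-, hz'p0, hzwp⟩ := electrode_trivial (r := r) (F := F) hL hlp htp hbppos
    (fun x hx => hrpos x (hsubp hx)) (hr.continuousOn.mono hsubp) (hwc.mono hsubp)
    (fun x hx => hz x (Or.inr hx)) (fun x hx => (hz'c x (Or.inr hx)).continuousWithinAt) hz'p
    (fun x hx => hw x ⟨by linarith [hx.1], hx.2⟩) (fun x _ => hFw x) hFzp hz'L₂ hz'L (Or.inl rfl)
  have hF0 : ∀ x ∈ Ioo 0 L, F x = 0 := fun x hx => by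
    rcases lt_or_ge x L₁ with h | h
    · have := hFzm x ⟨hx.1, h⟩
      rwa [hz'm0 x ⟨hx.1.le, h.le⟩, mul_zero, add_zero, hFL₁] at this
    · rcases le_or_gt x (L₁ + δ) with h' | h'
      · rw [hFs x ⟨h, h'⟩, hFL₁]
      · have := hFzp x ⟨h', hx.2⟩
        rwa [hz'p0 x ⟨h'.le, hx.2.le⟩, mul_zero, add_zero] at this
  have hw0 : ∀ x ∈ Icc 0 L, w x = 0 := fun x hx => by
    rw [eq_left_of_hasDerivAt_zero hwc (fun t ht => ?_) x hx, ← hzwm 0 ⟨le_rfl, hL₁.le⟩, hz0]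
    have h := hF0 t ht
    rw [hFw] at h
    rw [← (mul_eq_zero.1 h).resolve_left (hrpos t (Ioo_subset_Icc_self ht)).ne']
    exact hw t ht
  refine ⟨fun x hx => sub_eq_zero.1 (hw0 x hx), ?_⟩
  rintro x (hx | hx)
  · exact sub_eq_zero.1 ((hzwm x hx).trans (hw0 x (hsubm hx)))
  · exact sub_eq_zero.1 ((hzwp x hx).trans (hw0 x (hsubp hx)))
end
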